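/- arXiv:2603.25003 — 2 statements merged into one kernel-verified Lean document; each statement's English description precedes it below -/
import Mathlib

section
/- In the polynomial ring ℂ[x₀, x₁, x₂, x₃], the ideal consisting of all polynomials f such that f(s³, s²t, st², t³) = 0 for all s, t ∈ ℂ is equal to the ideal generated by the three quadrics x₁² − x₀x₂, x₁x₂ − x₀x₃, and x₁x₃ − x₂². -/
open MvPolynomial

/-- The normal form, in terms of elements `y i` of a ring, of the monomial `sᵃtᵇ` of the cubic
Veronese ring: `y 0 ^ p * y 3 ^ q` times one of `1`, `y 1`, `y 2`. It is zero if `3 ∤ a + b`. -/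
def cubicNormalForm {A : Type*} [CommRing A] (y : Fin 4 → A) (a b : ℕ) : A :=
  if (a + b) % 3 = 0 then
    y 0 ^ (a / 3) * y 3 ^ (b / 3) * (if a % 3 = 0 then 1 else if a % 3 = 1 then y 2 else y 1)
  else 0

/-- The exponents of `s` in the parametrization of the twisted cubic. -/
def cubicExponent : Fin 4 → ℕ := ![3, 2, 1, 0]

/-- The monomials parametrizing the cone over the twisted cubic. -/
noncomputable def cubicParam (i : Fin 4) : MvPolynomial (Fin 2) ℂ :=
  X 0 ^ cubicExponent i * X 1 ^ (3 - cubicExponent i)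

theorem cubicNormalForm_add {A : Type*} [CommRing A] {y : Fin 4 → A}
    (h₁ : y 1 ^ 2 = y 0 * y 2) (h₂ : y 1 * y 2 = y 0 * y 3) (h₃ : y 1 * y 3 = y 2 ^ 2)
    (i : Fin 4) (a b : ℕ) :
    cubicNormalForm y (a + cubicExponent i) (b + (3 - cubicExponent i)) =
      cubicNormalForm y a b * y i := by
  have hi : cubicExponent i ≤ 3 := by fin_cases i <;> simp [cubicExponent]
  by_cases hab : (a + b) % 3 = 0
  · have hab' : (a + cubicExponent i + (b + (3 - cubicExponent i))) % 3 = 0 := by omega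
    rw [cubicNormalForm, cubicNormalForm, if_pos hab', if_pos hab]
    have hdiv (n : ℕ) : (3 * n + 1) / 3 = n ∧ (3 * n + 2) / 3 = n ∧ (3 * n + 3) / 3 = n + 1 ∧
        (3 * n + 4) / 3 = n + 1 ∧ (3 * n + 5) / 3 = n + 1 := by omega
    have hmod (n : ℕ) : (3 * n + 1) % 3 = 1 ∧ (3 * n + 2) % 3 = 2 ∧ (3 * n + 3) % 3 = 0 ∧
        (3 * n + 4) % 3 = 1 ∧ (3 * n + 5) % 3 = 2 := by omega
    obtain ⟨p, q, ⟨rfl, rfl⟩ | ⟨rfl, rfl⟩ | ⟨rfl, rfl⟩⟩ : ∃ p q, (a = 3 * p ∧ b = 3 * q) ∨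
        (a = 3 * p + 1 ∧ b = 3 * q + 2) ∨ (a = 3 * p + 2 ∧ b = 3 * q + 1) :=
      ⟨a / 3, b / 3, by omega⟩
    all_goals
      clear hab hab' hi
      fin_cases i <;> simp [cubicExponent, add_assoc, hdiv, hmod] <;> grind
  · rw [cubicNormalForm, cubicNormalForm, if_neg (by omega), if_neg hab, zero_mul]

theorem mem_ideal_of_aeval_cubicParam_eq_zero {I : Ideal (MvPolynomial (Fin 4) ℂ)}
    (h₁ : X 1 ^ 2 - X 0 * X 2 ∈ I) (h₂ : X 1 * X 2 - X 0 * X 3 ∈ I)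
    (h₃ : X 1 * X 3 - X 2 ^ 2 ∈ I) {f : MvPolynomial (Fin 4) ℂ}
    (hf : aeval cubicParam f = 0) : f ∈ I := by
  let y : Fin 4 → MvPolynomial (Fin 4) ℂ ⧸ I := fun i => Ideal.Quotient.mk I (X i)
  let L : MvPolynomial (Fin 2) ℂ →ₗ[ℂ] MvPolynomial (Fin 4) ℂ ⧸ I :=
    (basisMonomials (Fin 2) ℂ).constr ℂ fun n => cubicNormalForm y (n 0) (n 1)
  have hL (n : Fin 2 →₀ ℕ) (c : ℂ) : L (monomial n c) = c • cubicNormalForm y (n 0) (n 1) := by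
    have : monomial n c = c • basisMonomials (Fin 2) ℂ n := by
      simp [smul_monomial]
    rw [this, map_smul, Module.Basis.constr_basis]
  have hmul (q : MvPolynomial (Fin 2) ℂ) (i : Fin 4) : L (q * cubicParam i) = L q * y i := by
    induction q using MvPolynomial.induction_on' with
    | add p q hp hq => rw [add_mul, map_add, hp, hq, map_add, add_mul]
    | monomial n c =>
      have : monomial n c * cubicParam i = monomial (n + (Finsupp.single 0 (cubicExponent i) +
          Finsupp.single 1 (3 - cubicExponent i))) c := by
        simp [cubicParam, X_pow_eq_monomial, monomial_mul]
      rw [this, hL, hL, smul_mul_assoc, ← cubicNormalForm_add]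
      · simp
      · simpa [y] using Ideal.Quotient.eq.2 h₁
      · simpa [y] using Ideal.Quotient.eq.2 h₂
      · simpa [y] using Ideal.Quotient.eq.2 h₃
  have key (p : MvPolynomial (Fin 4) ℂ) : L (aeval cubicParam p) = Ideal.Quotient.mk I p := by
    induction p using MvPolynomial.induction_on with
    | C c =>
      rw [aeval_C, algebraMap_eq, ← monomial_zero', hL]
      simp only [cubicNormalForm, Finsupp.coe_zero, Pi.zero_apply]
      simp only [add_zero, Nat.zero_mod, Nat.zero_div, pow_zero, mul_one, if_true]
      rw [← mul_one (C c : MvPolynomial (Fin 4) ℂ), ← smul_eq_C_mul]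
      rfl
    | add p q hp hq => rw [map_add, map_add, hp, hq, map_add]
    | mul_X p i hp => rw [map_mul, aeval_X, hmul, hp, map_mul]
  rw [← Ideal.Quotient.eq_zero_iff_mem, ← key, hf, map_zero]

/-- In `ℂ[x₀, x₁, x₂, x₃]`, the vanishing ideal of the affine cone over the standard
twisted cubic, i.e. the set of polynomials with `f(s³, s²t, st², t³) = 0` for all
`s, t ∈ ℂ`, equals the ideal generated by `x₁² − x₀x₂`, `x₁x₂ − x₀x₃`, `x₁x₃ − x₂²`. -/
theorem twisted_cubic_vanishing_ideal :
    {f : MvPolynomial (Fin 4) ℂ |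
        ∀ s t : ℂ, eval ![s ^ 3, s ^ 2 * t, s * t ^ 2, t ^ 3] f = 0}
      = ↑(Ideal.span ({X 1 ^ 2 - X 0 * X 2, X 1 * X 2 - X 0 * X 3, X 1 * X 3 - X 2 ^ 2} :
          Set (MvPolynomial (Fin 4) ℂ))) := by
  ext f
  rw [Set.mem_ofPred_eq, SetLike.mem_coe]
  constructor
  · intro h
    refine mem_ideal_of_aeval_cubicParam_eq_zero (Ideal.subset_span (by simp))
      (Ideal.subset_span (by simp)) (Ideal.subset_span (by simp)) (MvPolynomial.funext fun v => ?_)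
    have hv : (fun i => eval v (cubicParam i)) =
        ![v 0 ^ 3, v 0 ^ 2 * v 1, v 0 * v 1 ^ 2, v 1 ^ 3] := by
      ext i
      fin_cases i <;> simp [cubicParam, cubicExponent]
    have hcomp : eval v (aeval cubicParam f) = eval (fun i => eval v (cubicParam i)) f := by
      rw [map_aeval, algebraMap_eq, show (eval v).comp C = RingHom.id ℂ by ext; simp]
      rfl
    rw [hcomp, hv, h, map_zero]
  · intro h s t
    rw [← RingHom.mem_ker]
    refine Ideal.span_le.2 ?_ h
    rintro _ (rfl | rfl | rfl) <;> simp [RingHom.mem_ker] <;> ring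
end

section
/- Let M be an invertible 4×4 matrix with real entries, let t₁ ≠ t₂ and s₁ ≠ s₂ be complex numbers, and suppose both M·v(s₁) and M·v(s₂) lie in L = span{v(t₁), v(t₂)} ⊆ ℂ⁴. Then L is stable under coordinatewise complex conjugation if and only if both {t₁, t₂} = {conj(t₁), conj(t₂)} and {s₁, s₂} = {conj(s₁), conj(s₂)}. Consequently, a common real secant line is exactly one of: totally real (t₁, t₂, s₁, s₂ all real), partially real (exactly one of the pairs {t₁, t₂}, {s₁, s₂} consists of real numbers and the other is a nonreal complex conjugate pair), or minimally real (both pairs are nonreal complex conjugate pairs). -/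
noncomputable section

/-- `v(a) = (1, a, a², a³) ∈ ℂ⁴`. -/
def tcv (a : ℂ) : Fin 4 → ℂ := ![1, a, a ^ 2, a ^ 3]

/-- A subspace `L ⊆ ℂ⁴` is conjugation-stable if the coordinatewise complex conjugate of
every vector of `L` lies in `L`. -/
def ConjStable (L : Submodule ℂ (Fin 4 → ℂ)) : Prop :=
  ∀ w ∈ L, (fun i => (starRingEnd ℂ) (w i)) ∈ L

theorem eq_or_eq_of_tcv_mem_span {a b c : ℂ}
    (h : tcv c ∈ Submodule.span ℂ ({tcv a, tcv b} : Set (Fin 4 → ℂ))) : c = a ∨ c = b := by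
  obtain ⟨x, y, hxy⟩ := Submodule.mem_span_pair.1 h
  have e₀ := congrFun hxy 0
  have e₁ := congrFun hxy 1
  have e₂ := congrFun hxy 2
  simp [tcv] at e₀ e₁ e₂
  have key : (c - a) * (c - b) = 0 := by
    linear_combination (-1 : ℂ) * e₂ + (a + b) * e₁ - a * b * e₀
  rcases mul_eq_zero.1 key with h | h
  · exact Or.inl (sub_eq_zero.1 h)
  · exact Or.inr (sub_eq_zero.1 h)

theorem finrank_span_tcv_pair {a b : ℂ} (hab : a ≠ b) :
    Module.finrank ℂ (Submodule.span ℂ ({tcv a, tcv b} : Set (Fin 4 → ℂ))) = 2 := by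
  have hli : LinearIndependent ℂ ![tcv a, tcv b] := by
    rw [LinearIndependent.pair_iff]
    intro x y hxy
    have e₀ := congrFun hxy 0
    have e₁ := congrFun hxy 1
    simp [tcv] at e₀ e₁
    have hx : x * (a - b) = 0 := by linear_combination e₁ - b * e₀
    have hx0 : x = 0 := (mul_eq_zero.1 hx).resolve_right (sub_ne_zero.2 hab)
    exact ⟨hx0, by simpa [hx0] using e₀⟩
  rw [← Matrix.range_cons_cons_empty (tcv a) (tcv b) ![], finrank_span_eq_card hli, Fintype.card_fin]

theorem conj_tcv (a : ℂ) :
    (fun i => (starRingEnd ℂ) (tcv a i)) = tcv ((starRingEnd ℂ) a) := by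
  funext i
  fin_cases i <;> simp [tcv]

theorem conj_map_ofReal_mulVec (M : Matrix (Fin 4) (Fin 4) ℝ) (w : Fin 4 → ℂ) :
    (fun i => (starRingEnd ℂ) ((M.map Complex.ofReal).mulVec w i)) =
      (M.map Complex.ofReal).mulVec (fun i => (starRingEnd ℂ) (w i)) := by
  funext i
  simp [Matrix.mulVec, dotProduct]

theorem conjStable_span_tcv_pair_iff {a b : ℂ} (hab : a ≠ b) :
    ConjStable (Submodule.span ℂ ({tcv a, tcv b} : Set (Fin 4 → ℂ))) ↔
      ({a, b} : Set ℂ) = {(starRingEnd ℂ) a, (starRingEnd ℂ) b} := by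
  constructor
  · intro h
    have ha := h (tcv a) (Submodule.subset_span (by simp))
    have hb := h (tcv b) (Submodule.subset_span (by simp))
    rw [conj_tcv] at ha hb
    have hne : (starRingEnd ℂ) a ≠ (starRingEnd ℂ) b :=
      fun e => hab ((starRingEnd ℂ).injective e)
    rw [Set.pair_eq_pair_iff]
    rcases eq_or_eq_of_tcv_mem_span ha with ha | ha <;>
      rcases eq_or_eq_of_tcv_mem_span hb with hb | hb
    · exact absurd (ha.trans hb.symm) hne
    · exact Or.inl ⟨ha.symm, hb.symm⟩
    · exact Or.inr ⟨hb.symm, ha.symm⟩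
    · exact absurd (ha.trans hb.symm) hne
  · intro h w hw
    obtain ⟨x, y, rfl⟩ := Submodule.mem_span_pair.1 hw
    have hmem : ∀ c ∈ ({a, b} : Set ℂ), (fun i => (starRingEnd ℂ) (tcv c i)) ∈
        Submodule.span ℂ ({tcv a, tcv b} : Set (Fin 4 → ℂ)) := by
      intro c hc
      have hc' : (starRingEnd ℂ) c ∈ ({a, b} : Set ℂ) := by
        rw [h]
        rcases hc with rfl | rfl <;> simp
      rw [conj_tcv]
      apply Submodule.subset_span
      rcases hc' with e | e <;> simp [show (starRingEnd ℂ) c = _ from e]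
    have hsum := Submodule.add_mem _
      (Submodule.smul_mem _ ((starRingEnd ℂ) x) (hmem a (by simp)))
      (Submodule.smul_mem _ ((starRingEnd ℂ) y) (hmem b (by simp)))
    convert hsum using 1
    funext i
    simp

theorem map_mulVec_span_tcv_pair_eq {A : Matrix (Fin 4) (Fin 4) ℂ}
    (hA : Function.Injective A.mulVec) {t₁ t₂ s₁ s₂ : ℂ} (ht : t₁ ≠ t₂) (hs : s₁ ≠ s₂)
    (h₁ : A.mulVec (tcv s₁) ∈ Submodule.span ℂ ({tcv t₁, tcv t₂} : Set (Fin 4 → ℂ)))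
    (h₂ : A.mulVec (tcv s₂) ∈ Submodule.span ℂ ({tcv t₁, tcv t₂} : Set (Fin 4 → ℂ))) :
    (Submodule.span ℂ ({tcv s₁, tcv s₂} : Set (Fin 4 → ℂ))).map A.mulVecLin =
      Submodule.span ℂ ({tcv t₁, tcv t₂} : Set (Fin 4 → ℂ)) := by
  apply Submodule.eq_of_le_of_finrank_eq
  · rw [Submodule.map_span_le]
    rintro _ (rfl | rfl)
    · exact h₁
    · exact h₂
  · rw [(Submodule.equivMapOfInjective A.mulVecLin hA _).symm.finrank_eq,
      finrank_span_tcv_pair hs, finrank_span_tcv_pair ht]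

/-- A conjugation-stable line pulls back to a conjugation-stable line under an injective
real matrix. -/
theorem ConjStable.of_map_mulVecLin {M : Matrix (Fin 4) (Fin 4) ℝ}
    (hM : Function.Injective (M.map Complex.ofReal).mulVec) {K : Submodule ℂ (Fin 4 → ℂ)}
    (h : ConjStable (K.map (M.map Complex.ofReal).mulVecLin)) : ConjStable K := by
  intro w hw
  have hc := h _ (Submodule.mem_map_of_mem hw)
  rw [Matrix.mulVecLin_apply, conj_map_ofReal_mulVec] at hc
  obtain ⟨u, hu, e⟩ := hc
  exact hM e ▸ hu

theorem im_eq_zero_or_conj_of_pair_eq {a b : ℂ}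
    (h : ({a, b} : Set ℂ) = {(starRingEnd ℂ) a, (starRingEnd ℂ) b}) :
    (a.im = 0 ∧ b.im = 0) ∨ (a.im ≠ 0 ∧ b = (starRingEnd ℂ) a) := by
  rw [Set.pair_eq_pair_iff] at h
  rcases h with ⟨ha, hb⟩ | ⟨-, hb⟩
  · exact Or.inl ⟨Complex.conj_eq_iff_im.1 ha.symm, Complex.conj_eq_iff_im.1 hb.symm⟩
  · by_cases h0 : a.im = 0
    · exact Or.inl ⟨h0, by simp [hb, h0]⟩
    · exact Or.inr ⟨h0, hb⟩

/-- Let `M` be an invertible real 4×4 matrix, `t₁ ≠ t₂`, `s₁ ≠ s₂`, and suppose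
`M·v(s₁), M·v(s₂) ∈ L = span{v(t₁), v(t₂)}`.  Then `L` is conjugation-stable iff
`{t₁, t₂} = {conj t₁, conj t₂}` and `{s₁, s₂} = {conj s₁, conj s₂}`; consequently, a
common real secant line is exactly one of: totally real, partially real, or minimally
real. -/
theorem real_common_secant_classification (M : Matrix (Fin 4) (Fin 4) ℝ)
    (hM : IsUnit M.det) (t₁ t₂ s₁ s₂ : ℂ) (ht : t₁ ≠ t₂) (hs : s₁ ≠ s₂)
    (h₁ : (M.map Complex.ofReal).mulVec (tcv s₁) ∈
      Submodule.span ℂ ({tcv t₁, tcv t₂} : Set (Fin 4 → ℂ)))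
    (h₂ : (M.map Complex.ofReal).mulVec (tcv s₂) ∈
      Submodule.span ℂ ({tcv t₁, tcv t₂} : Set (Fin 4 → ℂ))) :
    (ConjStable (Submodule.span ℂ ({tcv t₁, tcv t₂} : Set (Fin 4 → ℂ))) ↔
      (({t₁, t₂} : Set ℂ) = {(starRingEnd ℂ) t₁, (starRingEnd ℂ) t₂} ∧
       ({s₁, s₂} : Set ℂ) = {(starRingEnd ℂ) s₁, (starRingEnd ℂ) s₂})) ∧
    (ConjStable (Submodule.span ℂ ({tcv t₁, tcv t₂} : Set (Fin 4 → ℂ))) →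
      -- totally real
      ((t₁.im = 0 ∧ t₂.im = 0 ∧ s₁.im = 0 ∧ s₂.im = 0) ∨
      -- partially real
       ((t₁.im = 0 ∧ t₂.im = 0 ∧ s₁.im ≠ 0 ∧ s₂ = (starRingEnd ℂ) s₁) ∨
        (s₁.im = 0 ∧ s₂.im = 0 ∧ t₁.im ≠ 0 ∧ t₂ = (starRingEnd ℂ) t₁)) ∨
      -- minimally real
       (t₁.im ≠ 0 ∧ t₂ = (starRingEnd ℂ) t₁ ∧ s₁.im ≠ 0 ∧ s₂ = (starRingEnd ℂ) s₁))) := by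
  have hinj : Function.Injective (M.map Complex.ofReal).mulVec :=
    Matrix.mulVec_injective_of_isUnit
      (((Matrix.isUnit_iff_isUnit_det M).2 hM).map Complex.ofRealHom.mapMatrix)
  have hst : ConjStable (Submodule.span ℂ ({tcv t₁, tcv t₂} : Set (Fin 4 → ℂ))) →
      ({t₁, t₂} : Set ℂ) = {(starRingEnd ℂ) t₁, (starRingEnd ℂ) t₂} ∧
      ({s₁, s₂} : Set ℂ) = {(starRingEnd ℂ) s₁, (starRingEnd ℂ) s₂} := by
    intro h
    refine ⟨(conjStable_span_tcv_pair_iff ht).1 h, (conjStable_span_tcv_pair_iff hs).1 ?_⟩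
    rw [← map_mulVec_span_tcv_pair_eq hinj ht hs h₁ h₂] at h
    exact h.of_map_mulVecLin hinj
  refine ⟨⟨hst, fun h => (conjStable_span_tcv_pair_iff ht).2 h.1⟩, fun h => ?_⟩
  have hT := im_eq_zero_or_conj_of_pair_eq (hst h).1
  have hS := im_eq_zero_or_conj_of_pair_eq (hst h).2
  tauto
end
end
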